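/- If G and K are finite groups with gcd(|G|, |K|) = 1 and G acts on K, then H¹(G, H²(K,𝕋)) = 0 and H²(G, H¹(K,𝕋)) = 0, and consequently H³(Tot^*(A^{*,*}(K ⋊ G, 𝕋))) ≅ H³(K,𝕋)^G. -/

import Mathlib

set_option linter.unusedSectionVars false

namespace Stmt15

/-- Merge the entries at positions `i` and `i+1` of a tuple. -/
def mergeD {α : Type} [Mul α] {n : ℕ} (i : ℕ) (h : Fin (n + 1) → α) : Fin n → α :=
  fun j =>
    if (j : ℕ) < i then h j.castSucc
    else if (j : ℕ) = i then h j.castSucc * h j.succ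
    else h j.succ

variable (G K : Type) [Group G] [Group K] (ρ : G →* MulAut K)
variable (M : Type) [AddCommGroup M]

/-- The `(p,q)` group of the double bar cochain complex: maps `G^p × K^q → M`. -/
abbrev Cpq (p q : ℕ) : Type := ((Fin p → G) × (Fin q → K)) → M

/-- The differential `δ_G : C^{p,q} → C^{p+1,q}`. -/
def dGfun {p q : ℕ} (F : Cpq G K M p q) : Cpq G K M (p + 1) q := fun x =>
  F (fun j => x.1 j.succ, x.2) +
    ∑ i ∈ Finset.range p, ((-1 : ℤ) ^ (i + 1)) • F (mergeD i x.1, x.2) +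
    ((-1 : ℤ) ^ (p + 1)) •
      F (fun j => x.1 j.castSucc, fun j => ρ (x.1 (Fin.last p)) (x.2 j))

/-- The differential `δ_K : C^{p,q} → C^{p,q+1}`. -/
def dKfun {p q : ℕ} (F : Cpq G K M p q) : Cpq G K M p (q + 1) := fun x =>
  F (x.1, fun j => x.2 j.succ) +
    ∑ i ∈ Finset.range q, ((-1 : ℤ) ^ (i + 1)) • F (x.1, mergeD i x.2) +
    ((-1 : ℤ) ^ (q + 1)) • F (x.1, fun j => x.2 j.castSucc)

lemma dGfun_add {p q : ℕ} (F F' : Cpq G K M p q) :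
    dGfun G K ρ M (F + F') = dGfun G K ρ M F + dGfun G K ρ M F' := by
  funext x
  simp only [dGfun, Pi.add_apply, smul_add, Finset.sum_add_distrib]
  abel

lemma dKfun_add {p q : ℕ} (F F' : Cpq G K M p q) :
    dKfun G K M (F + F') = dKfun G K M F + dKfun G K M F' := by
  funext x
  simp only [dKfun, Pi.add_apply, smul_add, Finset.sum_add_distrib]
  abel

/-- `δ_G` as an additive homomorphism. -/
def dGhom (p q : ℕ) : Cpq G K M p q →+ Cpq G K M (p + 1) q :=
  AddMonoidHom.mk' (dGfun G K ρ M) (dGfun_add G K ρ M)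

/-- `δ_K` as an additive homomorphism. -/
def dKhom (p q : ℕ) : Cpq G K M p q →+ Cpq G K M p (q + 1) :=
  AddMonoidHom.mk' (dKfun G K M) (dKfun_add G K M)

/-- Reindexing of bidegrees. -/
def castC {p q p' q' : ℕ} (h1 : p = p') (h2 : q = q') (F : Cpq G K M p q) :
    Cpq G K M p' q' :=
  fun x => F (fun i => x.1 (Fin.cast h1 i), fun i => x.2 (Fin.cast h2 i))

lemma castC_add {p q p' q' : ℕ} (h1 : p = p') (h2 : q = q') (F F' : Cpq G K M p q) :
    castC G K M h1 h2 (F + F') = castC G K M h1 h2 F + castC G K M h1 h2 F' := rfl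

/-- The subgroup of normalized cochains. -/
def nrm (p q : ℕ) : AddSubgroup (Cpq G K M p q) where
  carrier := {F | ∀ x, ((∃ i, x.1 i = 1) ∨ (∃ i, x.2 i = 1)) → F x = 0}
  add_mem' := by
    intro a b ha hb x hx
    simp only [Pi.add_apply, ha x hx, hb x hx, add_zero]
  zero_mem' := by intro x _; rfl
  neg_mem' := by
    intro a ha x hx
    simp only [Pi.neg_apply, ha x hx, neg_zero]

/-- Degree `n` of the total complex of the full double complex `C^{*,*}`. -/
abbrev TotC (n : ℕ) : Type := ∀ p : Fin (n + 1), Cpq G K M (p : ℕ) (n - (p : ℕ))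

/-- Degree `n` of the total complex of `A^{*,*} = C^{*,*>0}` (0-th row removed). -/
abbrev TotA (n : ℕ) : Type := ∀ p : Fin n, Cpq G K M (p : ℕ) (n - (p : ℕ))

/-- Degree `n` of the total complex of `B^{*,*} = C^{*>0,*>0}` (0-th row and column
removed); the component indexed by `p : Fin (n-1)` has bidegree `(p+1, n-(p+1))`. -/
abbrev TotB (n : ℕ) : Type := ∀ p : Fin (n - 1), Cpq G K M ((p : ℕ) + 1) (n - ((p : ℕ) + 1))

/-- The total differential `δ_G ⊕ (-1)^p δ_K` of `C^{*,*}`, as a function. -/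
def totdFun {n : ℕ} (x : TotC G K M n) : TotC G K M (n + 1) := fun p =>
  (if h1 : 1 ≤ (p : ℕ) then
    castC G K M (by omega)
      (by
        show n - ((p : ℕ) - 1) = n + 1 - (p : ℕ)
        have := p.isLt; omega)
      (dGhom G K ρ M ((p : ℕ) - 1) (n - ((p : ℕ) - 1))
        (x ⟨(p : ℕ) - 1, by have := p.isLt; omega⟩))
  else 0) +
  ((-1 : ℤ) ^ (p : ℕ)) •
  (if h2 : (p : ℕ) ≤ n then
    castC G K M rfl (by omega)
      (dKhom G K M (p : ℕ) (n - (p : ℕ)) (x ⟨(p : ℕ), by omega⟩))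
  else 0)

lemma totdFun_add {n : ℕ} (x y : TotC G K M n) :
    totdFun G K ρ M (x + y) = totdFun G K ρ M x + totdFun G K ρ M y := by
  funext p
  by_cases h1 : 1 ≤ (p : ℕ) <;> by_cases h2 : (p : ℕ) ≤ n <;>
    simp only [totdFun, Pi.add_apply, dif_pos, dif_neg, h1, h2, map_add, castC_add,
      smul_add, add_zero, smul_zero, not_true, not_false_iff] <;> abel

/-- The total differential of `C^{*,*}` as an additive homomorphism. -/
def totd (n : ℕ) : TotC G K M n →+ TotC G K M (n + 1) :=
  AddMonoidHom.mk' (totdFun G K ρ M) (totdFun_add G K ρ M)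

/-- The total differential of `A^{*,*}`, as a function. -/
def totdAFun {n : ℕ} (x : TotA G K M n) : TotA G K M (n + 1) := fun p =>
  (if h1 : 1 ≤ (p : ℕ) then
    castC G K M (by omega)
      (by
        show n - ((p : ℕ) - 1) = n + 1 - (p : ℕ)
        have := p.isLt; omega)
      (dGhom G K ρ M ((p : ℕ) - 1) (n - ((p : ℕ) - 1))
        (x ⟨(p : ℕ) - 1, by have := p.isLt; omega⟩))
  else 0) +
  ((-1 : ℤ) ^ (p : ℕ)) •
  (if h2 : (p : ℕ) < n then
    castC G K M rfl (by omega)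
      (dKhom G K M (p : ℕ) (n - (p : ℕ)) (x ⟨(p : ℕ), h2⟩))
  else 0)

lemma totdAFun_add {n : ℕ} (x y : TotA G K M n) :
    totdAFun G K ρ M (x + y) = totdAFun G K ρ M x + totdAFun G K ρ M y := by
  funext p
  by_cases h1 : 1 ≤ (p : ℕ) <;> by_cases h2 : (p : ℕ) < n <;>
    simp only [totdAFun, Pi.add_apply, dif_pos, dif_neg, h1, h2, map_add, castC_add,
      smul_add, add_zero, smul_zero, not_true, not_false_iff] <;> abel

/-- The total differential of `A^{*,*}` as an additive homomorphism. -/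
def totdA (n : ℕ) : TotA G K M n →+ TotA G K M (n + 1) :=
  AddMonoidHom.mk' (totdAFun G K ρ M) (totdAFun_add G K ρ M)

/-- The total differential of `B^{*,*}`, as a function. -/
def totdBFun {n : ℕ} (x : TotB G K M n) : TotB G K M (n + 1) := fun p =>
  (if h1 : 1 ≤ (p : ℕ) then
    castC G K M (by omega)
      (by
        show n - (((p : ℕ) - 1) + 1) = n + 1 - ((p : ℕ) + 1)
        have := p.isLt; omega)
      (dGhom G K ρ M (((p : ℕ) - 1) + 1) (n - (((p : ℕ) - 1) + 1))
        (x ⟨(p : ℕ) - 1, by have := p.isLt; omega⟩))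
  else 0) +
  ((-1 : ℤ) ^ ((p : ℕ) + 1)) •
  (if h2 : (p : ℕ) < n - 1 then
    castC G K M rfl (by omega)
      (dKhom G K M ((p : ℕ) + 1) (n - ((p : ℕ) + 1)) (x ⟨(p : ℕ), h2⟩))
  else 0)

lemma totdBFun_add {n : ℕ} (x y : TotB G K M n) :
    totdBFun G K ρ M (x + y) = totdBFun G K ρ M x + totdBFun G K ρ M y := by
  funext p
  by_cases h1 : 1 ≤ (p : ℕ) <;> by_cases h2 : (p : ℕ) < n - 1 <;>
    simp only [totdBFun, Pi.add_apply, dif_pos, dif_neg, h1, h2, map_add, castC_add,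
      smul_add, add_zero, smul_zero, not_true, not_false_iff] <;> abel

/-- The total differential of `B^{*,*}` as an additive homomorphism. -/
def totdB (n : ℕ) : TotB G K M n →+ TotB G K M (n + 1) :=
  AddMonoidHom.mk' (totdBFun G K ρ M) (totdBFun_add G K ρ M)

/-- Normalized elements of the total complex of `C^{*,*}`. -/
def nrmC (n : ℕ) : AddSubgroup (TotC G K M n) :=
  AddSubgroup.pi Set.univ fun p => nrm G K M (p : ℕ) (n - (p : ℕ))

/-- Normalized elements of the total complex of `A^{*,*}`. -/
def nrmA (n : ℕ) : AddSubgroup (TotA G K M n) :=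
  AddSubgroup.pi Set.univ fun p => nrm G K M (p : ℕ) (n - (p : ℕ))

/-- Normalized elements of the total complex of `B^{*,*}`. -/
def nrmB (n : ℕ) : AddSubgroup (TotB G K M n) :=
  AddSubgroup.pi Set.univ fun p => nrm G K M ((p : ℕ) + 1) (n - ((p : ℕ) + 1))

/-- Normalized cocycles of `Tot^n(C^{*,*})`. -/
def ZC (n : ℕ) : AddSubgroup (TotC G K M n) := nrmC G K M n ⊓ (totd G K ρ M n).ker

/-- Normalized coboundaries of `Tot^n(C^{*,*})`. -/
def BC : ∀ n : ℕ, AddSubgroup (TotC G K M n)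
  | 0 => ⊥
  | n + 1 => AddSubgroup.map (totd G K ρ M n) (nrmC G K M n)

/-- The degree `n` cohomology of `Tot^*(C^{*,*}(K ⋊ G, M))`. -/
abbrev HC (n : ℕ) :=
  ZC G K ρ M n ⧸ (BC G K ρ M n).addSubgroupOf (ZC G K ρ M n)


/-- Normalized cocycles of `Tot^n(A^{*,*})`. -/
def ZA (n : ℕ) : AddSubgroup (TotA G K M n) := nrmA G K M n ⊓ (totdA G K ρ M n).ker

/-- Normalized coboundaries of `Tot^n(A^{*,*})`. -/
def BA : ∀ n : ℕ, AddSubgroup (TotA G K M n)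
  | 0 => ⊥
  | n + 1 => AddSubgroup.map (totdA G K ρ M n) (nrmA G K M n)

/-- The degree `n` cohomology of `Tot^*(A^{*,*}(K ⋊ G, M))`. -/
abbrev HA (n : ℕ) :=
  ZA G K ρ M n ⧸ (BA G K ρ M n).addSubgroupOf (ZA G K ρ M n)


/-- Normalized cocycles of `Tot^n(B^{*,*})`. -/
def ZB (n : ℕ) : AddSubgroup (TotB G K M n) := nrmB G K M n ⊓ (totdB G K ρ M n).ker

/-- Normalized coboundaries of `Tot^n(B^{*,*})`. -/
def BB : ∀ n : ℕ, AddSubgroup (TotB G K M n)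
  | 0 => ⊥
  | n + 1 => AddSubgroup.map (totdB G K ρ M n) (nrmB G K M n)

/-- The degree `n` cohomology of `Tot^*(B^{*,*}(K ⋊ G, M))`. -/
abbrev HB (n : ℕ) :=
  ZB G K ρ M n ⧸ (BB G K ρ M n).addSubgroupOf (ZB G K ρ M n)




/-- The circle group `𝕋 = ℝ/ℤ`, written additively. -/
abbrev 𝕋 : Type := AddCircle (1 : ℝ)

/-- The `G`-action on `K`-cochains (the column `p = 0` of the double complex):
`(g•F)(k₁,…,k_q) = F(g⁻¹(k₁),…,g⁻¹(k_q))`. -/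
def actq (g : G) {q : ℕ} (F : Cpq G K M 0 q) : Cpq G K M 0 q :=
  fun x => F (x.1, fun i => ρ g⁻¹ (x.2 i))

/-- The subgroup of 3-cocycles of `K` whose cohomology class is `G`-invariant;
its quotient by the 3-coboundaries is `H³(K,𝕋)^G`. -/
def ZK3inv : AddSubgroup (Cpq G K M 0 3) where
  carrier := {F | dKhom G K M 0 3 F = 0 ∧
    ∀ g : G, actq G K ρ M g F - F ∈ (dKhom G K M 0 2).range}
  add_mem' := by
    intro a b ha hb
    refine ⟨by rw [map_add, ha.1, hb.1, add_zero], fun g => ?_⟩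
    have h : actq G K ρ M g (a + b) - (a + b) =
        (actq G K ρ M g a - a) + (actq G K ρ M g b - b) := by
      have : actq G K ρ M g (a + b) = actq G K ρ M g a + actq G K ρ M g b := rfl
      rw [this]; abel
    rw [h]
    exact AddSubgroup.add_mem _ (ha.2 g) (hb.2 g)
  zero_mem' := by
    refine ⟨map_zero _, fun g => ?_⟩
    have : actq G K ρ M g (0 : Cpq G K M 0 3) - 0 = 0 := by
      have : actq G K ρ M g (0 : Cpq G K M 0 3) = 0 := rfl
      rw [this]; abel
    rw [this]
    exact AddSubgroup.zero_mem _
  neg_mem' := by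
    intro a ha
    refine ⟨by rw [map_neg, ha.1, neg_zero], fun g => ?_⟩
    have h : actq G K ρ M g (-a) - (-a) = -(actq G K ρ M g a - a) := by
      have : actq G K ρ M g (-a) = -(actq G K ρ M g a) := rfl
      rw [this]; abel
    rw [h]
    exact AddSubgroup.neg_mem _ (ha.2 g)

/-- `H³(K, M)^G`: the group of `G`-invariant degree `3` cohomology classes of `K`. -/
abbrev H3KinvG :=
  ZK3inv G K ρ M ⧸ ((dKhom G K M 0 2).range.addSubgroupOf (ZK3inv G K ρ M))

section Contraction

variable {G K ρ M}

lemma mergeD_zero_cons {α : Type} [Mul α] {n : ℕ} (a : α) (x : Fin (n + 1) → α) :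
    mergeD 0 (Fin.cons a x : Fin (n + 2) → α) = Fin.cons (a * x 0) (fun j => x j.succ) := by
  funext j
  refine Fin.cases ?_ (fun j => ?_) j <;> simp [mergeD]

lemma mergeD_succ_cons {α : Type} [Mul α] {n : ℕ} (i : ℕ) (a : α) (x : Fin (n + 1) → α) :
    mergeD (i + 1) (Fin.cons a x : Fin (n + 2) → α) = Fin.cons a (mergeD i x) := by
  funext j
  refine Fin.cases ?_ (fun j => ?_) j <;> simp [mergeD]

lemma cons_castSucc {α : Type} {n : ℕ} (a : α) (x : Fin (n + 1) → α) :
    (fun j : Fin (n + 1) => (Fin.cons a x : Fin (n + 2) → α) j.castSucc) =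
      Fin.cons a fun j => x j.castSucc := by
  funext j
  refine Fin.cases ?_ (fun j => ?_) j <;> simp

lemma mergeD_map {α β : Type} [Monoid α] [Monoid β] (f : α →* β) {n : ℕ} (i : ℕ)
    (x : Fin (n + 1) → α) : mergeD i (fun j => f (x j)) = fun j => f (mergeD i x j) := by
  funext j
  simp only [mergeD]
  split_ifs <;> simp

/-- Summation over the first `K`-variable. -/
def sumK [Fintype K] {p q : ℕ} (F : Cpq G K M p (q + 1)) : Cpq G K M p q :=
  fun x => ∑ k : K, F (x.1, Fin.cons k x.2)

/-- Summation over the first `G`-variable. -/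
def sumG [Fintype G] {p q : ℕ} (F : Cpq G K M (p + 1) q) : Cpq G K M p q :=
  fun x => ∑ g : G, F (Fin.cons g x.1, x.2)

lemma sumK_neg [Fintype K] {p q : ℕ} (F : Cpq G K M p (q + 1)) : sumK (-F) = -sumK F := by
  funext x
  simp [sumK]

lemma sumK_zero [Fintype K] {p q : ℕ} : sumK (0 : Cpq G K M p (q + 1)) = 0 := by
  funext x
  simp [sumK]

lemma sumG_neg [Fintype G] {p q : ℕ} (F : Cpq G K M (p + 1) q) : sumG (-F) = -sumG F := by
  funext x
  simp [sumG]

lemma sumG_zero [Fintype G] {p q : ℕ} : sumG (0 : Cpq G K M (p + 1) q) = 0 := by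
  funext x
  simp [sumG]

lemma sumK_mem_nrm [Fintype K] {p q : ℕ} {F : Cpq G K M p (q + 1)}
    (hF : F ∈ nrm G K M p (q + 1)) : sumK F ∈ nrm G K M p q := by
  intro x hx
  refine Finset.sum_eq_zero fun k _ => hF _ ?_
  rcases hx with h | ⟨i, hi⟩
  · exact Or.inl h
  · exact Or.inr ⟨i.succ, by simpa using hi⟩

lemma sumG_mem_nrm [Fintype G] {p q : ℕ} {F : Cpq G K M (p + 1) q}
    (hF : F ∈ nrm G K M (p + 1) q) : sumG F ∈ nrm G K M p q := by
  intro x hx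
  refine Finset.sum_eq_zero fun k _ => hF _ ?_
  rcases hx with ⟨i, hi⟩ | h
  · exact Or.inl ⟨i.succ, by simpa using hi⟩
  · exact Or.inr h

/-- `sumK` is a contracting homotopy for multiplication by `|K|`. -/
lemma sumK_dK [Fintype K] {p q : ℕ} (F : Cpq G K M p (q + 1)) :
    sumK (dKhom G K M p (q + 1) F) = Fintype.card K • F - dKhom G K M p q (sumK F) := by
  funext ⟨x, y⟩
  have shift : ∑ k : K, F (x, Fin.cons (k * y 0) fun j => y j.succ) =
      ∑ k : K, F (x, Fin.cons k fun j => y j.succ) :=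
    Fintype.sum_equiv (Equiv.mulRight (y 0)) _ _ fun k => rfl
  simp only [sumK, dKhom, AddMonoidHom.mk'_apply, dKfun, Pi.sub_apply, Pi.smul_apply,
    Finset.sum_range_succ', Finset.sum_add_distrib, mergeD_zero_cons, mergeD_succ_cons,
    cons_castSucc, Fin.cons_succ, ← Finset.smul_sum, shift]
  rw [Finset.sum_comm]
  simp only [← Finset.smul_sum, Finset.sum_const, Finset.card_univ, pow_succ, zero_add, pow_zero,
    mul_neg, mul_one, neg_neg, neg_smul, one_smul, Finset.sum_neg_distrib]
  abel

/-- `sumG` is a contracting homotopy for multiplication by `|G|` in positive degrees. -/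
lemma sumG_dG [Fintype G] {p q : ℕ} (F : Cpq G K M (p + 1) q) :
    sumG (dGhom G K ρ M (p + 1) q F) = Fintype.card G • F - dGhom G K ρ M p q (sumG F) := by
  funext ⟨x, y⟩
  have shift : ∑ g : G, F (Fin.cons (g * x 0) fun j => x j.succ, y) =
      ∑ g : G, F (Fin.cons g fun j => x j.succ, y) :=
    Fintype.sum_equiv (Equiv.mulRight (x 0)) _ _ fun g => rfl
  have last (g : G) : (Fin.cons g x : Fin (p + 2) → G) (Fin.last (p + 1)) = x (Fin.last p) := by
    rw [← Fin.succ_last, Fin.cons_succ]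
  simp only [sumG, dGhom, AddMonoidHom.mk'_apply, dGfun, Pi.sub_apply, Pi.smul_apply,
    Finset.sum_range_succ', Finset.sum_add_distrib, mergeD_zero_cons, mergeD_succ_cons,
    cons_castSucc, Fin.cons_succ, last, ← Finset.smul_sum, shift]
  rw [Finset.sum_comm]
  simp only [← Finset.smul_sum, Finset.sum_const, Finset.card_univ, pow_succ, zero_add, pow_zero,
    mul_neg, mul_one, neg_neg, neg_smul, one_smul, Finset.sum_neg_distrib]
  abel

lemma sumK_dG [Fintype K] {p q : ℕ} (F : Cpq G K M p (q + 1)) :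
    sumK (dGhom G K ρ M p (q + 1) F) = dGhom G K ρ M p q (sumK F) := by
  funext ⟨x, y⟩
  have shift : ∑ k : K, F (fun j => x j.castSucc,
        fun j => ρ (x (Fin.last p)) ((Fin.cons k y : Fin (q + 1) → K) j)) =
      ∑ k : K, F (fun j => x j.castSucc, Fin.cons k fun j => ρ (x (Fin.last p)) (y j)) := by
    refine Fintype.sum_equiv (ρ (x (Fin.last p))).toEquiv _ _ fun k => ?_
    congr 2
    funext j
    refine Fin.cases ?_ (fun j => ?_) j <;> simp
  simp only [sumK, dGhom, AddMonoidHom.mk'_apply, dGfun, Finset.sum_add_distrib,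
    ← Finset.smul_sum, shift]
  rw [Finset.sum_comm]
  simp only [← Finset.smul_sum]

lemma sumG_dK [Fintype G] {p q : ℕ} (F : Cpq G K M (p + 1) q) :
    sumG (dKhom G K M (p + 1) q F) = dKhom G K M p q (sumG F) := by
  funext ⟨x, y⟩
  simp only [sumG, dKhom, AddMonoidHom.mk'_apply, dKfun, Finset.sum_add_distrib,
    ← Finset.smul_sum]
  rw [Finset.sum_comm]
  simp only [← Finset.smul_sum]

/-- On `C^{p,0}` the differential `δ_K` vanishes. -/
lemma dK_zero {p : ℕ} (F : Cpq G K M p 0) : dKhom G K M p 0 F = 0 := by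
  funext ⟨x, y⟩
  simp only [dKhom, AddMonoidHom.mk'_apply, dKfun, Finset.range_zero, Finset.sum_empty]
  have : (fun j : Fin 0 => y j.succ) = fun j => y j.castSucc := Subsingleton.elim _ _
  simp [this]

/-- Cocycles of positive degree are killed by `|K|` modulo coboundaries. -/
lemma card_smul_of_dK_eq_zero [Fintype K] {p q : ℕ} {F : Cpq G K M p (q + 1)}
    (hF : dKhom G K M p (q + 1) F = 0) :
    Fintype.card K • F = dKhom G K M p q (sumK F) := by
  have h := sumK_dK F
  rw [hF, sumK_zero] at h
  exact (sub_eq_zero.mp h.symm)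

end Contraction

section Action

variable {G K ρ M}

lemma dK_actq (g : G) {q : ℕ} (F : Cpq G K M 0 q) :
    dKhom G K M 0 q (actq G K ρ M g F) = actq G K ρ M g (dKhom G K M 0 q F) := by
  funext ⟨x, y⟩
  have h (i : ℕ) := mergeD_map (ρ g⁻¹).toMonoidHom i (n := q)
  simp only [MulEquiv.toMonoidHom_eq_coe, MonoidHom.coe_coe] at h
  simp only [dKhom, AddMonoidHom.mk'_apply, dKfun, actq, h]

lemma actq_sub (g : G) {q : ℕ} (F F' : Cpq G K M 0 q) :
    actq G K ρ M g (F - F') = actq G K ρ M g F - actq G K ρ M g F' := rfl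

lemma actq_zero (g : G) {q : ℕ} : actq G K ρ M g (0 : Cpq G K M 0 q) = 0 := rfl

lemma actq_zsmul (g : G) {q : ℕ} (s : ℤ) (F : Cpq G K M 0 q) :
    actq G K ρ M g (s • F) = s • actq G K ρ M g F := rfl

lemma actq_sum (g : G) {q : ℕ} {ι : Type} (t : Finset ι) (F : ι → Cpq G K M 0 q) :
    actq G K ρ M g (∑ i ∈ t, F i) = ∑ i ∈ t, actq G K ρ M g (F i) := by
  funext x
  simp [actq]

lemma dG_zero_apply {q : ℕ} (F : Cpq G K M 0 q) (x : Fin 1 → G) (y : Fin q → K) :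
    dGhom G K ρ M 0 q F (x, y) = F (Fin.elim0, y) - F (Fin.elim0, fun j => ρ (x 0) (y j)) := by
  simp only [dGhom, AddMonoidHom.mk'_apply, dGfun, Finset.range_zero, Finset.sum_empty]
  rw [show (fun j : Fin 0 => x j.succ) = Fin.elim0 from Subsingleton.elim _ _,
    show (fun j : Fin 0 => x j.castSucc) = Fin.elim0 from Subsingleton.elim _ _]
  simp [sub_eq_add_neg]

lemma dG_one_apply {q : ℕ} (F : Cpq G K M 1 q) (x : Fin 2 → G) (y : Fin q → K) :
    dGhom G K ρ M 1 q F (x, y) = F (fun _ => x 1, y) - F (fun _ => x 0 * x 1, y) +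
      F (fun _ => x 0, fun j => ρ (x 1) (y j)) := by
  have h0 : (fun j : Fin 1 => x j.succ) = fun _ => x 1 := by
    funext j; fin_cases j; rfl
  have h1 : mergeD 0 x = fun _ => x 0 * x 1 := by
    funext j; fin_cases j; rfl
  have h2 : (fun j : Fin 1 => x j.castSucc) = fun _ => x 0 := by
    funext j; fin_cases j; rfl
  simp only [dGhom, AddMonoidHom.mk'_apply, dGfun, Finset.sum_range_one, h0, h1, h2]
  norm_num
  abel

lemma dG_dG_zero {q : ℕ} (F : Cpq G K M 0 q) :
    dGhom G K ρ M 1 q (dGhom G K ρ M 0 q F) = 0 := by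
  funext ⟨x, y⟩
  simp only [dG_one_apply, dG_zero_apply, map_mul, MulAut.mul_apply, Pi.zero_apply]
  abel

lemma dK_dG_zero {q : ℕ} (F : Cpq G K M 0 q) :
    dKhom G K M 1 q (dGhom G K ρ M 0 q F) = dGhom G K ρ M 0 (q + 1) (dKhom G K M 0 q F) := by
  funext ⟨x, y⟩
  have h (i : ℕ) := mergeD_map (ρ (x 0)).toMonoidHom i (n := q)
  simp only [MulEquiv.toMonoidHom_eq_coe, MonoidHom.coe_coe] at h
  simp only [dKhom, AddMonoidHom.mk'_apply, dKfun, dG_zero_apply, h, smul_sub,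
    Finset.sum_sub_distrib]
  abel

lemma dG_zero_mem_nrm {q : ℕ} {F : Cpq G K M 0 q} (hF : F ∈ nrm G K M 0 q) :
    dGhom G K ρ M 0 q F ∈ nrm G K M 1 q := by
  rintro ⟨x, y⟩ (⟨i, hi⟩ | ⟨i, hi⟩)
  · obtain rfl := Subsingleton.elim i 0
    simp only at hi
    simp [dG_zero_apply, hi]
  · rw [dG_zero_apply, hF _ (Or.inr ⟨i, hi⟩), hF _ (Or.inr ⟨i, by simp only at hi; simp [hi]⟩),
      sub_zero]

/-- The norm `∑_g g • F`. -/
def normG [Fintype G] (ρ : G →* MulAut K) {q : ℕ} (F : Cpq G K M 0 q) : Cpq G K M 0 q :=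
  ∑ g : G, actq G K ρ M g F

lemma dK_normG [Fintype G] {q : ℕ} (F : Cpq G K M 0 q) :
    dKhom G K M 0 q (normG ρ F) = normG ρ (dKhom G K M 0 q F) := by
  simp only [normG, map_sum, dK_actq]

lemma dG_normG [Fintype G] {q : ℕ} (F : Cpq G K M 0 q) :
    dGhom G K ρ M 0 q (normG ρ F) = 0 := by
  funext ⟨x, y⟩
  rw [dG_zero_apply, Pi.zero_apply, sub_eq_zero]
  simp only [normG, Finset.sum_apply, actq]
  refine Fintype.sum_equiv (Equiv.mulLeft (x 0)) _ _ fun g => ?_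
  simp only [Equiv.coe_mulLeft, mul_inv_rev, map_mul, MulAut.mul_apply]
  congr 2
  funext j
  simp [← MulAut.mul_apply]

lemma normG_mem_nrm [Fintype G] {q : ℕ} {F : Cpq G K M 0 q} (hF : F ∈ nrm G K M 0 q) :
    normG ρ F ∈ nrm G K M 0 q := by
  refine AddSubgroup.sum_mem _ fun g _ x hx => hF _ ?_
  rcases hx with h | ⟨i, hi⟩
  · exact Or.inl h
  · exact Or.inr ⟨i, by simp [hi]⟩

end Action

section Normalization

variable {G K ρ M}

lemma dK_two_apply {p : ℕ} (F : Cpq G K M p 2) (x : Fin p → G) (a b c : K) :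
    dKhom G K M p 2 F (x, ![a, b, c]) =
      F (x, ![b, c]) - F (x, ![a * b, c]) + F (x, ![a, b * c]) - F (x, ![a, b]) := by
  have h0 : (fun j : Fin 2 => (![a, b, c] : Fin 3 → K) j.succ) = ![b, c] := by
    funext j; fin_cases j <;> rfl
  have h1 : mergeD 0 (![a, b, c] : Fin 3 → K) = ![a * b, c] := by
    funext j; fin_cases j <;> rfl
  have h2 : mergeD 1 (![a, b, c] : Fin 3 → K) = ![a, b * c] := by
    funext j; fin_cases j <;> rfl
  have h3 : (fun j : Fin 2 => (![a, b, c] : Fin 3 → K) j.castSucc) = ![a, b] := by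
    funext j; fin_cases j <;> rfl
  simp only [dKhom, AddMonoidHom.mk'_apply, dKfun, Finset.sum_range_succ, Finset.range_zero,
    Finset.sum_empty, zero_add, h0, h1, h2, h3]
  norm_num
  abel

lemma dK_three_apply {p : ℕ} (F : Cpq G K M p 3) (x : Fin p → G) (a b c d : K) :
    dKhom G K M p 3 F (x, ![a, b, c, d]) =
      F (x, ![b, c, d]) - F (x, ![a * b, c, d]) + F (x, ![a, b * c, d]) -
        F (x, ![a, b, c * d]) + F (x, ![a, b, c]) := by
  have h0 : (fun j : Fin 3 => (![a, b, c, d] : Fin 4 → K) j.succ) = ![b, c, d] := by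
    funext j; fin_cases j <;> rfl
  have h1 : mergeD 0 (![a, b, c, d] : Fin 4 → K) = ![a * b, c, d] := by
    funext j; fin_cases j <;> rfl
  have h2 : mergeD 1 (![a, b, c, d] : Fin 4 → K) = ![a, b * c, d] := by
    funext j; fin_cases j <;> rfl
  have h3 : mergeD 2 (![a, b, c, d] : Fin 4 → K) = ![a, b, c * d] := by
    funext j; fin_cases j <;> rfl
  have h4 : (fun j : Fin 3 => (![a, b, c, d] : Fin 4 → K) j.castSucc) = ![a, b, c] := by
    funext j; fin_cases j <;> rfl
  simp only [dKhom, AddMonoidHom.mk'_apply, dKfun, Finset.sum_range_succ, Finset.range_zero,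
    Finset.sum_empty, zero_add, h0, h1, h2, h3, h4]
  norm_num
  abel

lemma dK_dK_two {p : ℕ} (F : Cpq G K M p 2) :
    dKhom G K M p 3 (dKhom G K M p 2 F) = 0 := by
  funext ⟨x, y⟩
  obtain ⟨a, b, c, d, rfl⟩ : ∃ a b c d, y = ![a, b, c, d] :=
    ⟨y 0, y 1, y 2, y 3, by funext j; fin_cases j <;> rfl⟩
  simp only [dK_three_apply, dK_two_apply, mul_assoc, Pi.zero_apply]
  abel

/-- A normalized coboundary of degree `3` is the coboundary of a normalized cochain. -/
lemma exists_nrm_of_dK_two_mem_nrm {y : Cpq G K M 0 2}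
    (hy : dKhom G K M 0 2 y ∈ nrm G K M 0 3) :
    ∃ z ∈ nrm G K M 0 2, dKhom G K M 0 2 z = dKhom G K M 0 2 y := by
  have hconst (x : Fin 0 → G) (a c : K) : y (x, ![1, c]) = y (x, ![a, 1]) := by
    have h := hy (x, ![a, 1, c]) (Or.inr ⟨1, rfl⟩)
    rw [dK_two_apply, mul_one, one_mul] at h
    rw [← sub_eq_zero, ← h]
    abel
  refine ⟨fun x => y x - y (x.1, ![1, 1]), ?_, ?_⟩
  · rintro ⟨x, k⟩ (⟨i, -⟩ | ⟨i, hi⟩)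
    · exact i.elim0
    · obtain ⟨a, b, rfl⟩ : ∃ a b, k = ![a, b] :=
        ⟨k 0, k 1, by funext j; fin_cases j <;> rfl⟩
      rw [sub_eq_zero]
      fin_cases i
      · obtain rfl : a = 1 := hi
        exact (hconst x 1 b).trans (hconst x 1 1).symm
      · obtain rfl : b = 1 := hi
        exact (hconst x a 1).symm
  · funext ⟨x, k⟩
    obtain ⟨a, b, c, rfl⟩ : ∃ a b c, k = ![a, b, c] :=
      ⟨k 0, k 1, k 2, by funext j; fin_cases j <;> rfl⟩
    simp only [dK_two_apply]
    abel

/-- Every `3`-cocycle of `K` is cohomologous to a normalized one. -/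
lemma exists_sub_dK_two_mem_nrm {F : Cpq G K M 0 3} (hF : dKhom G K M 0 3 F = 0) :
    ∃ u : Cpq G K M 0 2, F - dKhom G K M 0 2 u ∈ nrm G K M 0 3 := by
  have coc {F : Cpq G K M 0 3} (hF : dKhom G K M 0 3 F = 0) (x : Fin 0 → G) (a b c d : K) :
      F (x, ![b, c, d]) - F (x, ![a * b, c, d]) + F (x, ![a, b * c, d]) -
        F (x, ![a, b, c * d]) + F (x, ![a, b, c]) = 0 := by
    rw [← dK_three_apply, hF, Pi.zero_apply]
  have hone (x : Fin 0 → G) : F (x, ![1, 1, 1]) = 0 := by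
    simpa using coc hF x 1 1 1 1
  have hsplit (x : Fin 0 → G) (a c : K) :
      F (x, ![a, 1, c]) = F (x, ![1, 1, c]) + F (x, ![a, 1, 1]) := by
    have h := coc hF x a 1 1 c
    simp only [mul_one, one_mul] at h
    rw [← sub_eq_zero, ← neg_eq_zero, ← h]
    abel
  refine ⟨fun x => F (x.1, ![1, 1, x.2 1]) - F (x.1, ![x.2 0, 1, 1]), ?_⟩
  set u : Cpq G K M 0 2 := fun x => F (x.1, ![1, 1, x.2 1]) - F (x.1, ![x.2 0, 1, 1])
  have hF' : dKhom G K M 0 3 (F - dKhom G K M 0 2 u) = 0 := by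
    rw [map_sub, hF, dK_dK_two, sub_zero]
  have hmid (x : Fin 0 → G) (a c : K) : (F - dKhom G K M 0 2 u) (x, ![a, 1, c]) = 0 := by
    rw [Pi.sub_apply, dK_two_apply, hsplit x a c]
    simp [u, hone]
  rintro ⟨x, k⟩ (⟨i, -⟩ | ⟨i, hi⟩)
  · exact i.elim0
  · obtain ⟨a, b, c, rfl⟩ : ∃ a b c, k = ![a, b, c] :=
      ⟨k 0, k 1, k 2, by funext j; fin_cases j <;> rfl⟩
    fin_cases i
    · obtain rfl : a = 1 := hi
      simpa only [one_mul, mul_one, hmid, sub_self, zero_add, sub_zero, add_zero]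
        using coc hF' x 1 1 b c
    · obtain rfl : b = 1 := hi
      exact hmid x a c
    · obtain rfl : c = 1 := hi
      simpa only [one_mul, mul_one, hmid, sub_self, zero_add, sub_zero, add_zero]
        using coc hF' x a b 1 1

end Normalization

section Total

variable {G K ρ M}

/-- The element of `Tot²(A)` with the given components. -/
def mkA2 (a : Cpq G K M 0 2) (b : Cpq G K M 1 1) : TotA G K M 2
  | ⟨0, _⟩ => a
  | ⟨1, _⟩ => b

/-- The element of `Tot³(A)` with the given components. -/
def mkA3 (a : Cpq G K M 0 3) (b : Cpq G K M 1 2) (c : Cpq G K M 2 1) : TotA G K M 3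
  | ⟨0, _⟩ => a
  | ⟨1, _⟩ => b
  | ⟨2, _⟩ => c

lemma exists_eq_mkA3 (x : TotA G K M 3) : ∃ a b c, x = mkA3 a b c :=
  ⟨x 0, x 1, x 2, by funext p; fin_cases p <;> rfl⟩

lemma mkA2_mem_nrmA {a : Cpq G K M 0 2} {b : Cpq G K M 1 1} (ha : a ∈ nrm G K M 0 2)
    (hb : b ∈ nrm G K M 1 1) : mkA2 a b ∈ nrmA G K M 2 := by
  intro p _
  fin_cases p
  · exact ha
  · exact hb

lemma mkA3_mem_nrmA_iff {a : Cpq G K M 0 3} {b : Cpq G K M 1 2} {c : Cpq G K M 2 1} :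
    mkA3 a b c ∈ nrmA G K M 3 ↔
      a ∈ nrm G K M 0 3 ∧ b ∈ nrm G K M 1 2 ∧ c ∈ nrm G K M 2 1 := by
  refine ⟨fun h => ⟨h 0 trivial, h 1 trivial, h 2 trivial⟩, fun ⟨ha, hb, hc⟩ p _ => ?_⟩
  fin_cases p
  · exact ha
  · exact hb
  · exact hc

lemma totdA_mkA2 (a : Cpq G K M 0 2) (b : Cpq G K M 1 1) :
    totdA G K ρ M 2 (mkA2 a b) = mkA3 (dKhom G K M 0 2 a)
      (dGhom G K ρ M 0 2 a - dKhom G K M 1 1 b) (dGhom G K ρ M 1 1 b) := by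
  funext p
  fin_cases p
  · exact (zero_add _).trans (one_smul ℤ _)
  · refine (congrArg (dGhom G K ρ M 0 2 a + ·) ?_).trans (sub_eq_add_neg _ _).symm
    exact (congrArg (· • _) (pow_one (-1 : ℤ))).trans (neg_one_zsmul _)
  · exact (congrArg (dGhom G K ρ M 1 1 b + ·) (smul_zero _)).trans (add_zero _)

lemma totdA_mkA3_eq_zero_iff {a : Cpq G K M 0 3} {b : Cpq G K M 1 2} {c : Cpq G K M 2 1} :
    totdA G K ρ M 3 (mkA3 a b c) = 0 ↔ dKhom G K M 0 3 a = 0 ∧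
      dGhom G K ρ M 0 3 a = dKhom G K M 1 2 b ∧
      dGhom G K ρ M 1 2 b = -dKhom G K M 2 1 c ∧ dGhom G K ρ M 2 1 c = 0 := by
  have h0 : totdA G K ρ M 3 (mkA3 a b c) 0 = dKhom G K M 0 3 a :=
    (zero_add _).trans (one_smul ℤ _)
  have h1 : totdA G K ρ M 3 (mkA3 a b c) 1 = dGhom G K ρ M 0 3 a - dKhom G K M 1 2 b := by
    refine (congrArg (dGhom G K ρ M 0 3 a + ·) ?_).trans (sub_eq_add_neg _ _).symm
    exact (congrArg (· • _) (pow_one (-1 : ℤ))).trans (neg_one_zsmul _)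
  have h2 : totdA G K ρ M 3 (mkA3 a b c) 2 = dGhom G K ρ M 1 2 b + dKhom G K M 2 1 c := by
    refine congrArg (dGhom G K ρ M 1 2 b + ·) ?_
    exact (congrArg (· • _) (neg_one_sq (R := ℤ))).trans (one_smul ℤ _)
  have h3 : totdA G K ρ M 3 (mkA3 a b c) 3 = dGhom G K ρ M 2 1 c :=
    (congrArg (dGhom G K ρ M 2 1 c + ·) (smul_zero _)).trans (add_zero _)
  rw [← sub_eq_zero (b := dKhom G K M 1 2 b), ← add_eq_zero_iff_eq_neg, ← h3]
  constructor
  · intro h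
    exact ⟨h0.symm.trans (congrFun h 0), h1.symm.trans (congrFun h 1),
      h2.symm.trans (congrFun h 2), congrFun h 3⟩
  · rintro ⟨k0, k1, k2, k3⟩
    funext p
    fin_cases p
    · exact h0.trans k0
    · exact h1.trans k1
    · exact h2.trans k2
    · exact k3

/-- `|K|` kills the third cohomology of `Tot(A)`. -/
lemma card_smul_mem_BA_of_mem_ZA [Fintype K] {x : TotA G K M 3} (hx : x ∈ ZA G K ρ M 3) :
    Fintype.card K • x ∈ BA G K ρ M 3 := by
  obtain ⟨a, b, c, rfl⟩ := exists_eq_mkA3 x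
  obtain ⟨ha, hb, -⟩ := mkA3_mem_nrmA_iff.mp hx.1
  obtain ⟨h0, h1, h2, -⟩ := totdA_mkA3_eq_zero_iff.mp hx.2
  refine ⟨mkA2 (sumK a) (-sumK b),
    mkA2_mem_nrmA (sumK_mem_nrm ha) (neg_mem (sumK_mem_nrm hb)), ?_⟩
  rw [totdA_mkA2, map_neg, map_neg, ← card_smul_of_dK_eq_zero h0, ← sumK_dG, ← sumK_dG, h1, h2,
    sumK_neg, sumK_dK, sumK_dK, dK_zero, neg_neg, sub_zero, sub_neg_eq_add, sub_add_cancel]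
  funext p
  fin_cases p <;> rfl

/-- `|G|` kills the classes with vanishing component in column `0`. -/
lemma card_smul_mkA3_zero_mem_BA [Fintype G] {b : Cpq G K M 1 2} {c : Cpq G K M 2 1}
    (hx : mkA3 0 b c ∈ ZA G K ρ M 3) :
    Fintype.card G • mkA3 0 b c ∈ BA G K ρ M 3 := by
  obtain ⟨-, hb, hc⟩ := mkA3_mem_nrmA_iff.mp hx.1
  obtain ⟨-, h1, h2, h3⟩ := totdA_mkA3_eq_zero_iff.mp hx.2
  rw [map_zero] at h1
  refine ⟨mkA2 (sumG b) (sumG c), mkA2_mem_nrmA (sumG_mem_nrm hb) (sumG_mem_nrm hc), ?_⟩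
  have hb' := sumG_dG (ρ := ρ) b
  rw [h2, sumG_neg, sumG_dK, neg_eq_iff_eq_neg, neg_sub] at hb'
  have hc' := sumG_dG (ρ := ρ) c
  rw [h3, sumG_zero, eq_comm, sub_eq_zero] at hc'
  rw [totdA_mkA2, hb', ← hc', ← sumG_dK, ← h1, sumG_zero, sub_sub_cancel]
  funext p
  fin_cases p
  · exact (smul_zero (A := Cpq G K M 0 3) (Fintype.card G)).symm
  · rfl
  · rfl

end Total

section Coprime

variable {G K ρ M}

lemma mem_of_coprime_nsmul_mem {A : Type} [AddCommGroup A] (H : AddSubgroup A) {m n : ℕ}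
    (hmn : Nat.Coprime m n) {x : A} (hm : m • x ∈ H) (hn : n • x ∈ H) : x ∈ H := by
  obtain ⟨s, t, hst⟩ := Nat.isCoprime_iff_coprime.mpr hmn
  rw [← one_smul ℤ x, ← hst, add_smul, mul_smul, mul_smul, natCast_zsmul, natCast_zsmul]
  exact add_mem (H.zsmul_mem hm s) (H.zsmul_mem hn t)

/-- `H¹(G, H²(K, M)) = 0` when `|G|` and `|K|` are coprime. -/
lemma exists_eq_coboundary_one [Fintype G] [Fintype K]
    (hcop : Nat.Coprime (Fintype.card G) (Fintype.card K)) (c : G → Cpq G K M 0 2)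
    (hc : ∀ g, dKhom G K M 0 2 (c g) = 0)
    (hcoc : ∀ g h, c (g * h) - c g - actq G K ρ M g (c h) ∈ (dKhom G K M 0 1).range) :
    ∃ b : Cpq G K M 0 2, dKhom G K M 0 2 b = 0 ∧
      ∀ g, c g - (actq G K ρ M g b - b) ∈ (dKhom G K M 0 1).range := by
  obtain ⟨s, t, hst⟩ := Nat.isCoprime_iff_coprime.mpr hcop
  refine ⟨-s • ∑ h, c h, by simp [hc], fun g => ?_⟩
  have hG := sum_mem fun h (_ : h ∈ Finset.univ) => hcoc g h
  have shift : ∑ h, c (g * h) = ∑ h, c h :=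
    Fintype.sum_equiv (Equiv.mulLeft g) _ _ fun h => rfl
  rw [Finset.sum_sub_distrib, Finset.sum_sub_distrib, shift, ← actq_sum, Finset.sum_const,
    Finset.card_univ, ← natCast_zsmul] at hG
  have hK : (Fintype.card K : ℤ) • c g ∈ (dKhom G K M 0 1).range := by
    rw [natCast_zsmul, card_smul_of_dK_eq_zero (hc g)]
    exact ⟨_, rfl⟩
  convert sub_mem (AddSubgroup.zsmul_mem _ hK t) (AddSubgroup.zsmul_mem _ hG s) using 1
  rw [actq_zsmul]
  conv_lhs => rw [← one_smul ℤ (c g), ← hst]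
  module

/-- `H²(G, H¹(K, M)) = 0` when `|G|` and `|K|` are coprime. -/
lemma exists_eq_coboundary_two [Fintype G] [Fintype K]
    (hcop : Nat.Coprime (Fintype.card G) (Fintype.card K)) (c : G → G → Cpq G K M 0 1)
    (hc : ∀ g h, dKhom G K M 0 1 (c g h) = 0)
    (hcoc : ∀ g₁ g₂ g₃, actq G K ρ M g₁ (c g₂ g₃) - c (g₁ * g₂) g₃ + c g₁ (g₂ * g₃) -
      c g₁ g₂ = 0) :
    ∃ b : G → Cpq G K M 0 1, (∀ g, dKhom G K M 0 1 (b g) = 0) ∧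
      ∀ g h, c g h = actq G K ρ M g (b h) - b (g * h) + b g := by
  obtain ⟨s, t, hst⟩ := Nat.isCoprime_iff_coprime.mpr hcop
  refine ⟨fun g => s • ∑ h, c g h, by simp [hc], fun g h => ?_⟩
  have hG := Finset.sum_congr (rfl : (Finset.univ : Finset G) = _) fun k _ => hcoc g h k
  have shift : ∑ k, c g (h * k) = ∑ k, c g k :=
    Fintype.sum_equiv (Equiv.mulLeft h) _ _ fun k => rfl
  rw [Finset.sum_sub_distrib, Finset.sum_add_distrib, Finset.sum_sub_distrib, shift, ← actq_sum,
    Finset.sum_const, Finset.sum_const_zero, Finset.card_univ, ← natCast_zsmul, sub_eq_zero] at hG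
  have hK : (Fintype.card K : ℤ) • c g h = 0 := by
    rw [natCast_zsmul, card_smul_of_dK_eq_zero (hc g h), dK_zero]
  rw [actq_zsmul, ← smul_sub, ← smul_add, hG]
  conv_lhs => rw [← one_smul ℤ (c g h), ← hst, add_smul, mul_smul, mul_smul, hK, smul_zero,
    add_zero]

variable (G K ρ M) in
/-- The edge map sending a cocycle of `Tot³(A)` to its component in column `0`. -/
def edgeZ : ZA G K ρ M 3 →+ ZK3inv G K ρ M where
  toFun x := ⟨x.1 0, by
    obtain ⟨x, hx⟩ := x
    obtain ⟨a, b, c, rfl⟩ := exists_eq_mkA3 x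
    obtain ⟨h0, h1, -, -⟩ := totdA_mkA3_eq_zero_iff.mp hx.2
    refine ⟨h0, fun g => ⟨-fun y => b (fun _ => g⁻¹, y.2), ?_⟩⟩
    funext ⟨y, k⟩
    have h := congrFun h1 (fun _ => g⁻¹, k)
    rw [dG_zero_apply, Subsingleton.elim Fin.elim0 y] at h
    rw [map_neg]
    exact (congrArg Neg.neg h.symm).trans (neg_sub _ _)⟩
  map_zero' := rfl
  map_add' _ _ := rfl

lemma BA_le_comap_edgeZ : (BA G K ρ M 3).addSubgroupOf (ZA G K ρ M 3) ≤
    ((dKhom G K M 0 2).range.addSubgroupOf (ZK3inv G K ρ M)).comap (edgeZ G K ρ M) := by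
  rintro ⟨_, hx⟩ ⟨y, -, rfl⟩
  exact ⟨y 0, ((zero_add _).trans (one_smul ℤ _)).symm⟩

variable (G K ρ M) in
/-- The edge map `H³(Tot(A)) → H³(K, M)^G`. -/
def edge : HA G K ρ M 3 →+ H3KinvG G K ρ M :=
  QuotientAddGroup.map _ _ (edgeZ G K ρ M) BA_le_comap_edgeZ

lemma edge_injective [Fintype G] [Fintype K]
    (hcop : Nat.Coprime (Fintype.card G) (Fintype.card K)) :
    Function.Injective (edge G K ρ M) := by
  rw [injective_iff_map_eq_zero]
  intro x
  induction x using QuotientAddGroup.induction_on with | _ x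
  intro hx
  obtain ⟨x, hxZ⟩ := x
  obtain ⟨y, hy⟩ : x 0 ∈ (dKhom G K M 0 2).range :=
    (QuotientAddGroup.eq_zero_iff (edgeZ G K ρ M ⟨x, hxZ⟩)).mp hx
  refine (QuotientAddGroup.eq_zero_iff _).mpr ?_
  change x ∈ BA G K ρ M 3
  obtain ⟨a, b, c, rfl⟩ := exists_eq_mkA3 x
  obtain rfl : dKhom G K M 0 2 y = a := hy
  refine mem_of_coprime_nsmul_mem _ hcop ?_ (card_smul_mem_BA_of_mem_ZA hxZ)
  obtain ⟨ha, hb, hc⟩ := mkA3_mem_nrmA_iff.mp hxZ.1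
  obtain ⟨z, hz, hzy⟩ := exists_nrm_of_dK_two_mem_nrm ha
  have hsub : mkA3 (dKhom G K M 0 2 y) b c =
      totdA G K ρ M 2 (mkA2 z 0) + mkA3 0 (b - dGhom G K ρ M 0 2 z) c := by
    rw [totdA_mkA2, map_zero, map_zero, sub_zero, hzy]
    funext p
    fin_cases p
    · exact (add_zero (dKhom G K M 0 2 y)).symm
    · exact (add_sub_cancel (dGhom G K ρ M 0 2 z) b).symm
    · exact (zero_add c).symm
  have hB : totdA G K ρ M 2 (mkA2 z 0) ∈ BA G K ρ M 3 :=
    ⟨_, mkA2_mem_nrmA hz (zero_mem _), rfl⟩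
  rw [hsub, smul_add]
  refine add_mem (nsmul_mem hB _) (card_smul_mkA3_zero_mem_BA ?_)
  obtain ⟨-, h1, h2, h3⟩ := totdA_mkA3_eq_zero_iff.mp hxZ.2
  refine ⟨mkA3_mem_nrmA_iff.mpr ⟨zero_mem _, sub_mem hb (dG_zero_mem_nrm hz), hc⟩,
    totdA_mkA3_eq_zero_iff.mpr ⟨map_zero _, ?_, ?_, h3⟩⟩
  · rw [map_zero, map_sub, dK_dG_zero, hzy, h1, sub_self]
  · rw [map_sub, dG_dG_zero, sub_zero, h2]

lemma edge_surjective [Fintype G] [Fintype K]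
    (hcop : Nat.Coprime (Fintype.card G) (Fintype.card K)) :
    Function.Surjective (edge G K ρ M) := by
  intro x
  induction x using QuotientAddGroup.induction_on with | _ x
  obtain ⟨F, hF⟩ := x
  obtain ⟨u, hu⟩ := exists_sub_dK_two_mem_nrm hF.1
  obtain ⟨s, t, hst⟩ := Nat.isCoprime_iff_coprime.mpr hcop
  set F' := F - dKhom G K M 0 2 u with hF'
  have hF'0 : dKhom G K M 0 3 F' = 0 := by rw [hF', map_sub, hF.1, dK_dK_two, sub_zero]
  have hZ : mkA3 (s • normG ρ F') 0 0 ∈ ZA G K ρ M 3 := by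
    refine ⟨mkA3_mem_nrmA_iff.mpr
      ⟨zsmul_mem (normG_mem_nrm hu) s, zero_mem _, zero_mem _⟩, ?_⟩
    refine totdA_mkA3_eq_zero_iff.mpr ⟨?_, ?_, ?_, ?_⟩
    · rw [map_zsmul, dK_normG, hF'0]
      simp [normG, actq_zero]
    · rw [map_zsmul, dG_normG, smul_zero, map_zero]
    · rw [map_zero, map_zero, neg_zero]
    · rw [map_zero]
  refine ⟨QuotientAddGroup.mk ⟨_, hZ⟩, QuotientAddGroup.eq_iff_sub_mem.mpr ?_⟩
  change s • normG ρ F' - F ∈ (dKhom G K M 0 2).range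
  have hinv (g : G) : actq G K ρ M g F' - F' ∈ (dKhom G K M 0 2).range := by
    rw [hF', actq_sub, ← dK_actq, sub_sub_sub_comm]
    exact sub_mem (hF.2 g) (sub_mem ⟨_, rfl⟩ ⟨_, rfl⟩)
  have hN := sum_mem fun g (_ : g ∈ Finset.univ) => hinv g
  rw [Finset.sum_sub_distrib, Finset.sum_const, Finset.card_univ, ← natCast_zsmul] at hN
  have hK : (Fintype.card K : ℤ) • F' ∈ (dKhom G K M 0 2).range := by
    rw [natCast_zsmul, card_smul_of_dK_eq_zero hF'0]
    exact ⟨_, rfl⟩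
  have hu' : dKhom G K M 0 2 u ∈ (dKhom G K M 0 2).range := ⟨_, rfl⟩
  convert sub_mem (sub_mem (zsmul_mem hN s) (zsmul_mem hK t)) hu' using 1
  have hF1 : F = (s * (Fintype.card G : ℤ) + t * (Fintype.card K : ℤ)) • F' +
      dKhom G K M 0 2 u := by
    rw [hst, one_smul, hF', sub_add_cancel]
  conv_lhs => rw [hF1]
  rw [normG]
  module

end Coprime

/-- If `G` and `K` are finite groups with `gcd(|G|,|K|) = 1` and `G`
acts on `K`, then `H¹(G, H²(K,𝕋)) = 0` and `H²(G, H¹(K,𝕋)) = 0`, and consequently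
`H³(Tot^*(A^{*,*}(K ⋊ G, 𝕋))) ≅ H³(K,𝕋)^G`. -/
theorem stmt_15 [Finite G] [Finite K]
    (hcop : Nat.Coprime (Nat.card G) (Nat.card K)) :
    -- `H¹(G, H²(K,𝕋)) = 0`: every 1-cocycle of `G` with values in `H²(K,𝕋)` is a
    -- 1-coboundary (stated via cochain representatives)
    (∀ c : G → Cpq G K 𝕋 0 2,
      (∀ g, dKhom G K 𝕋 0 2 (c g) = 0) →
      (∀ g h, c (g * h) - c g - actq G K ρ 𝕋 g (c h) ∈ (dKhom G K 𝕋 0 1).range) →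
      ∃ b : Cpq G K 𝕋 0 2, dKhom G K 𝕋 0 2 b = 0 ∧
        ∀ g, c g - (actq G K ρ 𝕋 g b - b) ∈ (dKhom G K 𝕋 0 1).range) ∧
    -- `H²(G, H¹(K,𝕋)) = 0`: every 2-cocycle of `G` with values in `Hom(K,𝕋)` is a
    -- 2-coboundary
    (∀ c : G → G → Cpq G K 𝕋 0 1,
      (∀ g h, dKhom G K 𝕋 0 1 (c g h) = 0) →
      (∀ g₁ g₂ g₃,
        actq G K ρ 𝕋 g₁ (c g₂ g₃) - c (g₁ * g₂) g₃ + c g₁ (g₂ * g₃) - c g₁ g₂ = 0) →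
      ∃ b : G → Cpq G K 𝕋 0 1, (∀ g, dKhom G K 𝕋 0 1 (b g) = 0) ∧
        ∀ g h, c g h = actq G K ρ 𝕋 g (b h) - b (g * h) + b g) ∧
    -- `H³(Tot^*(A^{*,*}(K ⋊ G, 𝕋))) ≅ H³(K,𝕋)^G`
    Nonempty (HA G K ρ 𝕋 3 ≃+ H3KinvG G K ρ 𝕋) := by
  cases nonempty_fintype G
  cases nonempty_fintype K
  rw [Nat.card_eq_fintype_card, Nat.card_eq_fintype_card] at hcop
  exact ⟨exists_eq_coboundary_one hcop, exists_eq_coboundary_two hcop,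
    ⟨AddEquiv.ofBijective (edge G K ρ 𝕋) ⟨edge_injective hcop, edge_surjective hcop⟩⟩⟩

end Stmt15
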